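/- Extension theorem: Let ρ be the higher-order GSOS law induced by a relatively flat higher-order GSOS law (ρ^j)_{j∈J}, and let z : Z → B(Z,Z) be a locally final coalgebra for B. Then there exists a Σ-algebra structure a_ρ : ΣZ → Z such that (Z, a_ρ, z) is a ρ-bialgebra. -/

import Mathlib

open CategoryTheory CategoryTheory.Limits Opposite

universe w v u

/-- A free `S`-algebra on an object `X` (providing the object `S*X` of the free monad). -/
structure FreeAlg {C : Type u} [Category.{v} C] (S : C ⥤ C) (X : C) where
  carrier : C
  emb : X ⟶ carrier
  act : S.obj carrier ⟶ carrier
  desc : ∀ {A : C}, (S.obj A ⟶ A) → (X ⟶ A) → (carrier ⟶ A)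
  emb_desc : ∀ {A : C} (a : S.obj A ⟶ A) (h : X ⟶ A), emb ≫ desc a h = h
  act_desc : ∀ {A : C} (a : S.obj A ⟶ A) (h : X ⟶ A),
    act ≫ desc a h = S.map (desc a h) ≫ a
  desc_unique : ∀ {A : C} (a : S.obj A ⟶ A) (h : X ⟶ A) (k : carrier ⟶ A),
    emb ≫ k = h → act ≫ k = S.map k ≫ a → k = desc a h

variable {C : Type u} [Category.{v} C] [HasBinaryProducts C] [HasBinaryCoproducts C]

/-- The action of the free monad `S*` on a morphism. -/
def freeMap {S : C ⥤ C} (F : ∀ X : C, FreeAlg S X) {X Y : C} (f : X ⟶ Y) :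
    (F X).carrier ⟶ (F Y).carrier :=
  (F X).desc (F Y).act (f ≫ (F Y).emb)

/-- A decomposition of `S` as a `J`-indexed coproduct `S = ∐_j S_j` of endofunctors
(coproducts of functors are computed pointwise). -/
structure Decomp (S : C ⥤ C) (J : Type w) where
  part : J → C ⥤ C
  inj : ∀ j : J, part j ⟶ S
  cdesc : ∀ (W : C) {T : C}, (∀ j : J, (part j).obj W ⟶ T) → (S.obj W ⟶ T)
  inj_cdesc : ∀ (W : C) {T : C} (f : ∀ j : J, (part j).obj W ⟶ T) (j : J),
    (inj j).app W ≫ cdesc W f = f j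
  cdesc_unique : ∀ (W : C) {T : C} (f : ∀ j : J, (part j).obj W ⟶ T) (k : S.obj W ⟶ T),
    (∀ j : J, (inj j).app W ≫ k = f j) → k = cdesc W f

/-- For each `j`, the functor `S_{<j} = ∐_{i<j} S_i`, again a pointwise coproduct. -/
structure LtDecomp {S : C ⥤ C} {J : Type w} (r : J → J → Prop) (D : Decomp S J) where
  functor : J → C ⥤ C
  inj : ∀ {i j : J}, r i j → (D.part i ⟶ functor j)
  cdesc : ∀ (j : J) (W : C) {T : C},
    (∀ i : J, r i j → ((D.part i).obj W ⟶ T)) → ((functor j).obj W ⟶ T)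
  inj_cdesc : ∀ (j : J) (W : C) {T : C} (f : ∀ i : J, r i j → ((D.part i).obj W ⟶ T))
    (i : J) (hij : r i j), (inj hij).app W ≫ cdesc j W f = f i hij
  cdesc_unique : ∀ (j : J) (W : C) {T : C} (f : ∀ i : J, r i j → ((D.part i).obj W ⟶ T))
    (k : (functor j).obj W ⟶ T),
    (∀ (i : J) (hij : r i j), (inj hij).app W ≫ k = f i hij) → k = cdesc j W f

/-- The component at `W` of the evident natural transformation `S_{<j} ⟶ S`. -/
def injLt {S : C ⥤ C} {J : Type w} {r : J → J → Prop} {D : Decomp S J}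
    (L : LtDecomp r D) (j : J) (W : C) : (L.functor j).obj W ⟶ S.obj W :=
  L.cdesc j W (fun i _ => (D.inj i).app W)

/-- The free extension `inj*_{<j} : S*_{<j} A ⟶ S* A` of the unit. -/
def injStar {S : C ⥤ C} {J : Type w} {r : J → J → Prop} {D : Decomp S J}
    (L : LtDecomp r D) (F : ∀ X : C, FreeAlg S X)
    (Flt : ∀ (j : J) (X : C), FreeAlg (L.functor j) X) (j : J) (A : C) :
    (Flt j A).carrier ⟶ (F A).carrier :=
  (Flt j A).desc (injLt L j ((F A).carrier) ≫ (F A).act) ((F A).emb)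

/-- The morphism `e_{j,A} = [inj*_{<j}, ι_A ∘ inj_j ∘ S_j inj*_{<j}] :
S*_{<j} A + S_j S*_{<j} A ⟶ S* A`. -/
noncomputable def eMor {S : C ⥤ C} {J : Type w} {r : J → J → Prop} {D : Decomp S J}
    (L : LtDecomp r D) (F : ∀ X : C, FreeAlg S X)
    (Flt : ∀ (j : J) (X : C), FreeAlg (L.functor j) X) (j : J) (A : C) :
    ((Flt j A).carrier ⨿ (D.part j).obj ((Flt j A).carrier)) ⟶ (F A).carrier :=
  coprod.desc (injStar L F Flt j A)
    ((D.part j).map (injStar L F Flt j A) ≫ (D.inj j).app ((F A).carrier) ≫ (F A).act)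

/-- A relatively flat higher-order GSOS law: a `J`-indexed family
`ρ^j_{X,Y} : S_j(X × B(X,Y)) ⟶ B(X, S*_{<j}(X+Y) + S_j S*_{<j}(X+Y))`
dinatural in `X` and natural in `Y`. -/
structure RelFlatLaw (S : C ⥤ C) (B : Cᵒᵖ × C ⥤ C) {J : Type w} {r : J → J → Prop}
    (D : Decomp S J) (L : LtDecomp r D)
    (Flt : ∀ (j : J) (X : C), FreeAlg (L.functor j) X) where
  app : ∀ (j : J) (X Y : C),
    (D.part j).obj (X ⨯ B.obj (op X, Y)) ⟶
      B.obj (op X, (Flt j (X ⨿ Y)).carrier ⨿ (D.part j).obj ((Flt j (X ⨿ Y)).carrier))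
  dinatural : ∀ (j : J) {X X' Y : C} (f : X ⟶ X'),
    (D.part j).map (prod.map f (𝟙 (B.obj (op X', Y)))) ≫ app j X' Y ≫
        B.map ((f.op, 𝟙 _) :
          (op X', (Flt j (X' ⨿ Y)).carrier ⨿ (D.part j).obj ((Flt j (X' ⨿ Y)).carrier)) ⟶
          (op X, (Flt j (X' ⨿ Y)).carrier ⨿ (D.part j).obj ((Flt j (X' ⨿ Y)).carrier)))
      = (D.part j).map (prod.map (𝟙 X) (B.map ((f.op, 𝟙 Y) : (op X', Y) ⟶ (op X, Y)))) ≫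
        app j X Y ≫
        B.map ((𝟙 (op X),
            coprod.map (freeMap (fun X => Flt j X) (coprod.map f (𝟙 Y)))
              ((D.part j).map (freeMap (fun X => Flt j X) (coprod.map f (𝟙 Y))))) :
          (op X, (Flt j (X ⨿ Y)).carrier ⨿ (D.part j).obj ((Flt j (X ⨿ Y)).carrier)) ⟶
          (op X, (Flt j (X' ⨿ Y)).carrier ⨿ (D.part j).obj ((Flt j (X' ⨿ Y)).carrier)))
  natural : ∀ (j : J) {X Y Y' : C} (g : Y ⟶ Y'),
    (D.part j).map (prod.map (𝟙 X) (B.map ((𝟙 (op X), g) : (op X, Y) ⟶ (op X, Y')))) ≫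
        app j X Y'
      = app j X Y ≫
        B.map ((𝟙 (op X),
            coprod.map (freeMap (fun X => Flt j X) (coprod.map (𝟙 X) g))
              ((D.part j).map (freeMap (fun X => Flt j X) (coprod.map (𝟙 X) g)))) :
          (op X, (Flt j (X ⨿ Y)).carrier ⨿ (D.part j).obj ((Flt j (X ⨿ Y)).carrier)) ⟶
          (op X, (Flt j (X ⨿ Y')).carrier ⨿ (D.part j).obj ((Flt j (X ⨿ Y')).carrier)))

/-- The higher-order GSOS law (components) induced by a relatively flat law. -/
noncomputable def inducedLaw {S : C ⥤ C} {B : Cᵒᵖ × C ⥤ C} {J : Type w} {r : J → J → Prop}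
    {D : Decomp S J} {L : LtDecomp r D} {Flt : ∀ (j : J) (X : C), FreeAlg (L.functor j) X}
    (F : ∀ X : C, FreeAlg S X) (ρ : RelFlatLaw S B D L Flt) (X Y : C) :
    S.obj (X ⨯ B.obj (op X, Y)) ⟶ B.obj (op X, (F (X ⨿ Y)).carrier) :=
  D.cdesc _ (fun j => ρ.app j X Y ≫
    B.map ((𝟙 (op X), eMor L F Flt j (X ⨿ Y)) :
      (op X, (Flt j (X ⨿ Y)).carrier ⨿ (D.part j).obj ((Flt j (X ⨿ Y)).carrier)) ⟶
      (op X, (F (X ⨿ Y)).carrier)))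

/-- `(X, a, c)` is a `ρ`-bialgebra for the law with components `ρ`. -/
def IsBialgebra (S : C ⥤ C) (B : Cᵒᵖ × C ⥤ C) (F : ∀ X : C, FreeAlg S X)
    (ρ : ∀ X Y : C, S.obj (X ⨯ B.obj (op X, Y)) ⟶ B.obj (op X, (F (X ⨿ Y)).carrier))
    (X : C) (a : S.obj X ⟶ X) (c : X ⟶ B.obj (op X, X)) : Prop :=
  a ≫ c = S.map (prod.lift (𝟙 X) c) ≫ ρ X X ≫
    B.map ((𝟙 (op X), (F (X ⨿ X)).desc a (coprod.desc (𝟙 X) (𝟙 X))) :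
      (op X, (F (X ⨿ X)).carrier) ⟶ (op X, X))

/-- A locally final coalgebra: a higher-order `B`-coalgebra `z : Z ⟶ B(Z,Z)` that is a
final coalgebra for the endofunctor `B(Z,−)`. -/
def IsLocallyFinal (B : Cᵒᵖ × C ⥤ C) (Z : C) (z : Z ⟶ B.obj (op Z, Z)) : Prop :=
  ∀ (X : C) (c : X ⟶ B.obj (op Z, X)),
    ∃! h : X ⟶ Z, h ≫ z = c ≫ B.map ((𝟙 (op Z), h) : (op Z, X) ⟶ (op Z, Z))

theorem map_id_comp (B : Cᵒᵖ × C ⥤ C) (Z : C) {X Y W : C} (f : X ⟶ Y) (g : Y ⟶ W) :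
    B.map ((𝟙 (op Z), f) : (op Z, X) ⟶ (op Z, Y)) ≫
        B.map ((𝟙 (op Z), g) : (op Z, Y) ⟶ (op Z, W))
      = B.map ((𝟙 (op Z), f ≫ g) : (op Z, X) ⟶ (op Z, W)) := by
  rw [← B.map_comp, prod_comp, Category.comp_id]

theorem map_id_id (B : Cᵒᵖ × C ⥤ C) (Z X : C) :
    B.map ((𝟙 (op Z), 𝟙 X) : (op Z, X) ⟶ (op Z, X)) = 𝟙 _ :=
  B.map_id (op Z, X)

/-- Flat corecursion into a locally final coalgebra: a morphism whose behaviour is specified by a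
step that either lands in `Z` or makes one corecursive call. -/
theorem IsLocallyFinal.exists_corec {B : Cᵒᵖ × C ⥤ C} {Z : C} {z : Z ⟶ B.obj (op Z, Z)}
    (hz : IsLocallyFinal B Z z) {W : C} (t : W ⟶ B.obj (op Z, Z ⨿ W)) :
    ∃ h : W ⟶ Z, h ≫ z = t ≫
      B.map ((𝟙 (op Z), coprod.desc (𝟙 Z) h) : (op Z, Z ⨿ W) ⟶ (op Z, Z)) := by
  obtain ⟨k, hk, -⟩ := hz (Z ⨿ W)
    (coprod.desc (z ≫ B.map ((𝟙 (op Z), coprod.inl) : (op Z, Z) ⟶ (op Z, Z ⨿ W))) t)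
  have hinl : coprod.inl ≫ k = 𝟙 Z := by
    refine (hz Z z).unique ?_ ?_
    · rw [Category.assoc, hk, coprod.inl_desc_assoc, Category.assoc, map_id_comp]
    · rw [map_id_id, Category.id_comp, Category.comp_id]
  have hdesc : coprod.desc (𝟙 Z) (coprod.inr ≫ k) = k := by
    apply coprod.hom_ext
    · rw [coprod.inl_desc, hinl]
    · rw [coprod.inr_desc]
  refine ⟨coprod.inr ≫ k, ?_⟩
  rw [hdesc, Category.assoc, hk, coprod.inr_desc_assoc]

/-- If `b : S_{<j} A ⟶ A` is the restriction of `a : S A ⟶ A`, then the structure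
`S*_{<j} X ⟶ A` induced by `b` is the restriction of the one induced by `a`. -/
theorem injStar_desc {S : C ⥤ C} {J : Type w} {r : J → J → Prop} {D : Decomp S J}
    (L : LtDecomp r D) (F : ∀ X : C, FreeAlg S X)
    (Flt : ∀ (j : J) (X : C), FreeAlg (L.functor j) X) (j : J) {X A : C}
    (a : S.obj A ⟶ A) (f : X ⟶ A) :
    injStar L F Flt j X ≫ (F X).desc a f =
      (Flt j X).desc (L.cdesc j A fun i _ => (D.inj i).app A ≫ a) f := by
  have hinj (W : C) {i : J} (hij : r i j) :
      (L.inj hij).app W ≫ injLt L j W = (D.inj i).app W :=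
    L.inj_cdesc j W _ i hij
  have hcdesc : injLt L j A ≫ a = L.cdesc j A fun i _ => (D.inj i).app A ≫ a :=
    L.cdesc_unique j A _ _ fun i hij => by rw [← Category.assoc, hinj]
  have hnat {V W : C} (g : V ⟶ W) :
      injLt L j V ≫ S.map g = (L.functor j).map g ≫ injLt L j W := by
    refine (L.cdesc_unique j V (fun i _ => (D.inj i).app V ≫ S.map g) _ fun i hij => ?_).trans
      (L.cdesc_unique j V _ _ fun i hij => ?_).symm
    · rw [← Category.assoc, hinj]
    · rw [← Category.assoc, ← (L.inj hij).naturality, Category.assoc, hinj,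
        (D.inj i).naturality]
  apply (Flt j X).desc_unique
  · rw [← Category.assoc, injStar, (Flt j X).emb_desc, (F X).emb_desc]
  · rw [← hcdesc, ← Category.assoc, injStar, (Flt j X).act_desc]
    simp only [Category.assoc, (F X).act_desc, Functor.map_comp]
    rw [← Category.assoc (injLt L j _), hnat, Category.assoc]

/-- The structure induced by `a : S A ⟶ A` on `S*_{<j} X + S_j S*_{<j} X` is determined by the
restrictions of `a` to `S_{<j}` and `S_j`. -/
theorem eMor_desc {S : C ⥤ C} {J : Type w} {r : J → J → Prop} {D : Decomp S J}
    (L : LtDecomp r D) (F : ∀ X : C, FreeAlg S X)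
    (Flt : ∀ (j : J) (X : C), FreeAlg (L.functor j) X) (j : J) {X A : C}
    (a : S.obj A ⟶ A) (f : X ⟶ A) :
    eMor L F Flt j X ≫ (F X).desc a f =
      coprod.desc ((Flt j X).desc (L.cdesc j A fun i _ => (D.inj i).app A ≫ a) f)
        ((D.part j).map ((Flt j X).desc (L.cdesc j A fun i _ => (D.inj i).app A ≫ a) f) ≫
          (D.inj j).app A ≫ a) := by
  rw [← injStar_desc L F Flt j a f]
  apply coprod.hom_ext
  · simp only [eMor, coprod.inl_desc, coprod.inl_desc_assoc]
  · simp only [eMor, coprod.inr_desc, coprod.inr_desc_assoc, Category.assoc, Functor.map_comp,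
      (F X).act_desc]
    rw [← (D.inj j).naturality_assoc]

/-- The components of the algebra structure on a locally final coalgebra exist, by well-founded
recursion. -/
theorem RelFlatLaw.exists_components {S : C ⥤ C} {B : Cᵒᵖ × C ⥤ C} {J : Type w}
    {r : J → J → Prop} (hwf : WellFounded r) {D : Decomp S J} {L : LtDecomp r D}
    {Flt : ∀ (j : J) (X : C), FreeAlg (L.functor j) X} (ρ : RelFlatLaw S B D L Flt)
    {Z : C} {z : Z ⟶ B.obj (op Z, Z)} (hz : IsLocallyFinal B Z z) {f : Z ⨿ Z ⟶ Z} :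
    ∃ a : ∀ j : J, (D.part j).obj Z ⟶ Z, ∀ j : J,
      a j ≫ z = (D.part j).map (prod.lift (𝟙 Z) z) ≫ ρ.app j Z Z ≫
        B.map ((𝟙 (op Z),
          coprod.desc ((Flt j (Z ⨿ Z)).desc (L.cdesc j Z fun i _ => a i) f)
            ((D.part j).map ((Flt j (Z ⨿ Z)).desc (L.cdesc j Z fun i _ => a i) f) ≫ a j)) :
          (op Z, (Flt j (Z ⨿ Z)).carrier ⨿ (D.part j).obj ((Flt j (Z ⨿ Z)).carrier)) ⟶
          (op Z, Z)) := by
  have step (j : J) (b : ∀ i : J, r i j → ((D.part i).obj Z ⟶ Z)) :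
      ∃ h : (D.part j).obj Z ⟶ Z,
        h ≫ z = (D.part j).map (prod.lift (𝟙 Z) z) ≫ ρ.app j Z Z ≫
          B.map ((𝟙 (op Z),
            coprod.desc ((Flt j (Z ⨿ Z)).desc (L.cdesc j Z b) f)
              ((D.part j).map ((Flt j (Z ⨿ Z)).desc (L.cdesc j Z b) f) ≫ h)) :
            (op Z, (Flt j (Z ⨿ Z)).carrier ⨿ (D.part j).obj ((Flt j (Z ⨿ Z)).carrier)) ⟶
            (op Z, Z)) := by
    let m := (Flt j (Z ⨿ Z)).desc (L.cdesc j Z b) f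
    obtain ⟨h, hh⟩ := hz.exists_corec ((D.part j).map (prod.lift (𝟙 Z) z) ≫ ρ.app j Z Z ≫
      B.map ((𝟙 (op Z), coprod.map m ((D.part j).map m)) :
        (op Z, (Flt j (Z ⨿ Z)).carrier ⨿ (D.part j).obj ((Flt j (Z ⨿ Z)).carrier)) ⟶
        (op Z, Z ⨿ (D.part j).obj Z)))
    refine ⟨h, ?_⟩
    rw [hh, Category.assoc, Category.assoc, map_id_comp, coprod.map_desc, Category.comp_id]
  choose s hs using step
  refine ⟨hwf.fix s, fun j => ?_⟩
  rw [hwf.fix_eq s j]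
  exact hs j _

/-- **Extension theorem.** If `ρ` is induced by a relatively flat
higher-order GSOS law over a well-founded relation, then every locally final coalgebra
`z : Z ⟶ B(Z,Z)` extends to a `ρ`-bialgebra `(Z, a_ρ, z)`. -/
theorem extension_theorem
    (S : C ⥤ C) (B : Cᵒᵖ × C ⥤ C) (F : ∀ X : C, FreeAlg S X)
    {J : Type w} {r : J → J → Prop} (hwf : WellFounded r)
    (D : Decomp S J) (L : LtDecomp r D)
    (Flt : ∀ (j : J) (X : C), FreeAlg (L.functor j) X)
    (Fj : ∀ (j : J) (X : C), FreeAlg (D.part j) X)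
    (ρ : RelFlatLaw S B D L Flt)
    (Z : C) (z : Z ⟶ B.obj (op Z, Z)) (hz : IsLocallyFinal B Z z) :
    ∃ a : S.obj Z ⟶ Z, IsBialgebra S B F (inducedLaw F ρ) Z a z := by
  obtain ⟨a, ha⟩ := ρ.exists_components hwf hz (f := coprod.desc (𝟙 Z) (𝟙 Z))
  refine ⟨D.cdesc Z a, ?_⟩
  refine (D.cdesc_unique Z (fun j => a j ≫ z) _ fun j => ?_).trans
    (D.cdesc_unique Z _ _ fun j => ?_).symm
  · rw [← Category.assoc, D.inj_cdesc]
  · rw [← (D.inj j).naturality_assoc, inducedLaw, ← Category.assoc ((D.inj j).app _),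
      D.inj_cdesc, Category.assoc, map_id_comp, eMor_desc, ha]
    simp only [D.inj_cdesc]
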